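/- Let P = (p, r) be a collectively jammed packing of n disks in a flat torus 𝕋² = ℝ²/Λ. Then there exists ε > 0 such that every packing Q = (q, s) of n disks in 𝕋² with |q − p| < ε, |s − r| < ε, and with the same contact graph as P (the same set of contact triples (i, j, λ)) is also collectively jammed. -/

import Mathlib

noncomputable section

open scoped RealInnerProductSpace

namespace IsostaticPaper

/-- Points of the Euclidean plane `ℝ²`. -/
abbrev Pt : Type := EuclideanSpace ℝ (Fin 2)

/-- The point `(x, y) ∈ ℝ²`. -/
def vec (x y : ℝ) : Pt := (WithLp.equiv 2 (Fin 2 → ℝ)).symm ![x, y]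

/-- The lattice `Λ ⊆ ℝ²` spanned over `ℤ` by the two vectors `v₁, v₂`. -/
def lat (v₁ v₂ : Pt) : Set Pt :=
  {l : Pt | ∃ z₁ z₂ : ℤ, l = (z₁ : ℝ) • v₁ + (z₂ : ℝ) • v₂}

/-- `(p, r)` is a packing of disks in the flat torus `ℝ²/Λ`:
all radii are positive and `‖pᵢ - pⱼ + λ‖ ≥ rᵢ + rⱼ` for all `i, j` and all
`λ ∈ Λ` with `(j, λ) ≠ (i, 0)`. -/
def IsPacking (Λ : Set Pt) {ι : Type} (p : ι → Pt) (r : ι → ℝ) : Prop :=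
  (∀ i, 0 < r i) ∧
  ∀ i j : ι, ∀ l ∈ Λ, ¬(j = i ∧ l = 0) → r i + r j ≤ ‖p i - p j + l‖

/-- A contact of the packing `(p, r)` is a triple `(i, j, λ)`, `λ ∈ Λ`,
`(j, λ) ≠ (i, 0)`, with `‖pᵢ - pⱼ + λ‖ = rᵢ + rⱼ`. -/
def IsContact (Λ : Set Pt) {ι : Type} (p : ι → Pt) (r : ι → ℝ) (c : ι × ι × Pt) : Prop :=
  c.2.2 ∈ Λ ∧ ¬(c.2.1 = c.1 ∧ c.2.2 = 0) ∧ ‖p c.1 - p c.2.1 + c.2.2‖ = r c.1 + r c.2.1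

/-- A packing `(p, r)` in `ℝ²/Λ` is collectively jammed if every continuous path of
configurations `t ↦ q t`, `t ∈ [0,1]`, starting at `p` and keeping `(q t, r)` a packing,
moves `p` only by translations. -/
def CollectivelyJammed (Λ : Set Pt) {ι : Type} (p : ι → Pt) (r : ι → ℝ) : Prop :=
  ∀ q : ℝ → ι → Pt,
    (∀ i, ContinuousOn (fun t => q t i) (Set.Icc 0 1)) →
    q 0 = p →
    (∀ t ∈ Set.Icc (0:ℝ) 1, IsPacking Λ (q t) r) →
    ∀ t ∈ Set.Icc (0:ℝ) 1, ∀ i j, q t i - p i = q t j - p j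

/-- Euclidean distance between two configurations of centers. -/
def pdist {ι : Type} [Fintype ι] (p q : ι → Pt) : ℝ :=
  Real.sqrt (∑ i, ‖p i - q i‖ ^ 2)

/-- Euclidean distance between two vectors of radii. -/
def rdist {ι : Type} [Fintype ι] (r s : ι → ℝ) : ℝ :=
  Real.sqrt (∑ i, (r i - s i) ^ 2)

/-- Determinant of the pair of lattice basis vectors `v₁, v₂`. -/
def det2 (v₁ v₂ : Pt) : ℝ := v₁ 0 * v₂ 1 - v₁ 1 * v₂ 0

/-- Density of a packing with radii `r` in the torus with lattice basis `v₁, v₂`. -/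
def density (v₁ v₂ : Pt) {ι : Type} [Fintype ι] (r : ι → ℝ) : ℝ :=
  Real.pi * (∑ i, r i ^ 2) / |det2 v₁ v₂|

/-- `(p, r)` is locally maximally dense in the torus with lattice basis `v₁, v₂`:
it is a packing and, for some `ε > 0`, every nearby packing whose radii are a positive
scalar multiple of `r` has density at most that of `(p, r)`. -/
def LocallyMaxDense (v₁ v₂ : Pt) {ι : Type} [Fintype ι] (p : ι → Pt) (r : ι → ℝ) : Prop :=
  IsPacking (lat v₁ v₂) p r ∧
  ∃ ε > 0, ∀ (q : ι → Pt) (t : ℝ), 0 < t →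
    IsPacking (lat v₁ v₂) q (fun i => t * r i) →
    pdist q p < ε → rdist (fun i => t * r i) r < ε →
    density v₁ v₂ (fun i => t * r i) ≤ density v₁ v₂ r

/-- An infinitesimal flex `p'` of the packing: `(pᵢ - pⱼ + λ) · (p'ᵢ - p'ⱼ) ≥ 0`
for every contact `(i, j, λ)`. -/
def IsInfFlex (Λ : Set Pt) {ι : Type} (p : ι → Pt) (r : ι → ℝ) (p' : ι → Pt) : Prop :=
  ∀ c : ι × ι × Pt, IsContact Λ p r c →
    0 ≤ ⟪p c.1 - p c.2.1 + c.2.2, p' c.1 - p' c.2.1⟫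

/-- The packing is infinitesimally rigid if every infinitesimal flex is trivial
(all `p'ᵢ` equal). -/
def InfinitesimallyRigid (Λ : Set Pt) {ι : Type} (p : ι → Pt) (r : ι → ℝ) : Prop :=
  ∀ p' : ι → Pt, IsInfFlex Λ p r p' → ∀ i j, p' i = p' j

/-- The space of equilibrium stresses of a packing whose (finite) set of ordered
contact triples is `K`: scalars on contacts with `ω(i,j,λ) = ω(j,i,-λ)`, vanishing off
`K`, in equilibrium at every vertex. -/
def stressSpace {n : ℕ} (K : Finset (Fin n × Fin n × Pt)) (p : Fin n → Pt) :
    Submodule ℝ ((Fin n × Fin n × Pt) → ℝ) where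
  carrier := {ω | (∀ c ∉ K, ω c = 0) ∧
    (∀ i j l, ω (i, j, l) = ω (j, i, -l)) ∧
    (∀ i, ∑ c ∈ K.filter (fun c => c.1 = i), ω c • (p c.1 - p c.2.1 + c.2.2) = 0)}
  zero_mem' := ⟨fun _ _ => rfl, fun _ _ _ => rfl, fun i => by simp⟩
  add_mem' := by
    rintro ω₁ ω₂ ⟨h1, h2, h3⟩ ⟨g1, g2, g3⟩
    refine ⟨fun c hc => ?_, fun i j l => ?_, fun i => ?_⟩
    · simp [h1 c hc, g1 c hc]
    · simp [h2 i j l, g2 i j l]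
    · simp only [Pi.add_apply, add_smul, Finset.sum_add_distrib, h3 i, g3 i, add_zero]
  smul_mem' := by
    rintro t ω ⟨h1, h2, h3⟩
    refine ⟨fun c hc => ?_, fun i j l => ?_, fun i => ?_⟩
    · simp [h1 c hc]
    · simp [h2 i j l]
    · simp only [Pi.smul_apply, smul_assoc, ← Finset.smul_sum, h3 i, smul_zero]


/-- The vectors of a lattice in the plane that lie in a bounded region are finitely many. -/
lemma finite_lat_norm_le (v₁ v₂ : Pt) (hli : LinearIndependent ℝ ![v₁, v₂]) (a : Pt) (R : ℝ) :
    {l ∈ lat v₁ v₂ | ‖a + l‖ ≤ R}.Finite := by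
  let b := basisOfLinearIndependentOfCardEqFinrank hli (by simp)
  have hb : (b : Fin 2 → Pt) = ![v₁, v₂] := by simp [b]
  refine (ZSpan.setFinite_inter b (s := Metric.closedBall (-a) R)
    Metric.isBounded_closedBall).subset ?_
  rintro l ⟨⟨z₁, z₂, rfl⟩, hl⟩
  refine ⟨?_, ?_⟩
  · rw [mem_closedBall_iff_norm, sub_neg_eq_add, add_comm]
    exact hl
  · rw [hb]
    refine add_mem ?_ ?_
    · rw [Int.cast_smul_eq_zsmul]
      exact Submodule.smul_mem _ _ (Submodule.subset_span ⟨0, by simp⟩)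
    · rw [Int.cast_smul_eq_zsmul]
      exact Submodule.smul_mem _ _ (Submodule.subset_span ⟨1, by simp⟩)

/-- The disks of a packing that do not touch are uniformly separated. -/
lemma IsPacking.exists_gap {v₁ v₂ : Pt} (hli : LinearIndependent ℝ ![v₁, v₂])
    {ι : Type} [Finite ι] {p : ι → Pt} {r : ι → ℝ} (hpack : IsPacking (lat v₁ v₂) p r) :
    ∃ g > 0, ∀ i j, ∀ l ∈ lat v₁ v₂, ¬(j = i ∧ l = 0) →
      ¬IsContact (lat v₁ v₂) p r (i, j, l) → r i + r j + g ≤ ‖p i - p j + l‖ := by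
  have key : ∀ᶠ g : ℝ in nhdsWithin 0 (Set.Ioi 0), ∀ i j,
      ∀ l ∈ {l ∈ lat v₁ v₂ | ‖p i - p j + l‖ ≤ r i + r j + 1}, ¬(j = i ∧ l = 0) →
      ¬IsContact (lat v₁ v₂) p r (i, j, l) → r i + r j + g ≤ ‖p i - p j + l‖ := by
    refine Filter.eventually_all.2 fun i => Filter.eventually_all.2 fun j => ?_
    refine (Filter.eventually_all_finite (finite_lat_norm_le v₁ v₂ hli _ _)).2 fun l hl => ?_
    by_cases h0 : j = i ∧ l = 0
    · exact Filter.Eventually.of_forall fun g h => absurd h0 h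
    by_cases hc : IsContact (lat v₁ v₂) p r (i, j, l)
    · exact Filter.Eventually.of_forall fun g _ h => absurd hc h
    have hlt : r i + r j < ‖p i - p j + l‖ :=
      lt_of_le_of_ne (hpack.2 i j l hl.1 h0) fun h => hc ⟨hl.1, h0, h.symm⟩
    filter_upwards [Ioo_mem_nhdsGT (sub_pos.2 hlt)] with g hg _ _
    linarith [hg.2]
  obtain ⟨g, ⟨hg, hg0, hg1⟩⟩ := (key.and (Ioo_mem_nhdsGT (zero_lt_one (α := ℝ)))).exists
  refine ⟨g, hg0, fun i j l hl h0 hc => ?_⟩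
  by_cases hle : ‖p i - p j + l‖ ≤ r i + r j + 1
  · exact hg i j l ⟨hl, hle⟩ h0 hc
  · linarith

/-- An infinitesimal flex of a packing of finitely many disks extends to a linear motion. -/
lemma CollectivelyJammed.infinitesimallyRigid {v₁ v₂ : Pt}
    (hli : LinearIndependent ℝ ![v₁, v₂]) {ι : Type} [Fintype ι] {p : ι → Pt} {r : ι → ℝ}
    (hpack : IsPacking (lat v₁ v₂) p r) (hjam : CollectivelyJammed (lat v₁ v₂) p r) :
    InfinitesimallyRigid (lat v₁ v₂) p r := by
  intro p' hflex
  obtain ⟨g, hg, hgap⟩ := hpack.exists_gap hli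
  have hM : 0 < 2 * ‖p'‖ + 1 := by positivity
  set τ : ℝ := g / (2 * ‖p'‖ + 1) with hτ
  have hτ0 : 0 < τ := by positivity
  have hτg : τ * (2 * ‖p'‖ + 1) = g := by rw [hτ]; field_simp
  intro i j
  have h := hjam (fun t k => p k + (t * τ) • p' k) (fun k => by fun_prop) (by simp) ?_ 1
    (by simp) i j
  · simp only [one_mul, add_sub_cancel_left] at h
    exact smul_right_injective Pt hτ0.ne' h
  rintro t ⟨ht0, ht1⟩
  have htτ : 0 ≤ t * τ := mul_nonneg ht0 hτ0.le
  refine ⟨hpack.1, fun i j l hl h0 => ?_⟩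
  have e : p i + (t * τ) • p' i - (p j + (t * τ) • p' j) + l
      = (p i - p j + l) + (t * τ) • (p' i - p' j) := by
    rw [smul_sub]; abel
  simp only [e]
  by_cases hc : IsContact (lat v₁ v₂) p r (i, j, l)
  · have h1 : 0 ≤ ⟪p i - p j + l, (t * τ) • (p' i - p' j)⟫ := by
      rw [inner_smul_right]
      exact mul_nonneg htτ (hflex (i, j, l) hc)
    have h2 := norm_add_sq_real (p i - p j + l) ((t * τ) • (p' i - p' j))
    have h3 : ‖p i - p j + l‖ = r i + r j := hc.2.2
    rw [← h3]
    refine (sq_le_sq₀ (norm_nonneg _) (norm_nonneg _)).1 ?_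
    linarith [sq_nonneg ‖(t * τ) • (p' i - p' j)‖]
  · have h1 := hgap i j l hl h0 hc
    have h2 : ‖(t * τ) • (p' i - p' j)‖ ≤ g := by
      rw [norm_smul, Real.norm_of_nonneg htτ]
      have h3 : ‖p' i - p' j‖ ≤ 2 * ‖p'‖ + 1 := by
        linarith [norm_sub_le (p' i) (p' j), norm_le_pi_norm p' i, norm_le_pi_norm p' j]
      calc t * τ * ‖p' i - p' j‖ ≤ 1 * τ * (2 * ‖p'‖ + 1) := by gcongr
        _ = g := by rw [one_mul, hτg]
    have h4 := norm_sub_le_norm_add (p i - p j + l) ((t * τ) • (p' i - p' j))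
    linarith

/-- Quantitative infinitesimal rigidity: every displacement that fixes the disk `i₀` brings
some pair of touching disks together at a rate at least proportional to its norm. -/
lemma InfinitesimallyRigid.exists_inner_le {Λ : Set Pt} {ι : Type} [Fintype ι] {p : ι → Pt}
    {r : ι → ℝ} (h : InfinitesimallyRigid Λ p r) (i₀ : ι) :
    ∃ c > 0, ∀ δ : ι → Pt, δ i₀ = 0 → δ ≠ 0 →
      ∃ k : ι × ι × Pt, IsContact Λ p r k ∧
        ⟪p k.1 - p k.2.1 + k.2.2, δ k.1 - δ k.2.1⟫ ≤ -(c * ‖δ‖) := by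
  let S : Set (ι → Pt) := Metric.sphere 0 1 ∩ {δ | δ i₀ = 0}
  have hS : IsCompact S :=
    (isCompact_sphere 0 1).inter_right (isClosed_eq (continuous_apply i₀) continuous_const)
  let U : ℕ → Set (ι → Pt) := fun m => ⋃ k ∈ {k | IsContact Λ p r k},
    {δ | ⟪p k.1 - p k.2.1 + k.2.2, δ k.1 - δ k.2.1⟫ < -(1 / ((m : ℝ) + 1))}
  have hU : ∀ m, IsOpen (U m) := fun m => isOpen_biUnion fun k _ =>
    isOpen_lt (by fun_prop) continuous_const
  have hcover : S ⊆ ⋃ m, U m := by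
    rintro δ ⟨hδ1, hδ0⟩
    have hnf : ¬IsInfFlex Λ p r δ := by
      intro hf
      have h0 : δ = 0 := funext fun i => (h δ hf i i₀).trans hδ0
      simp [h0] at hδ1
    simp only [IsInfFlex, not_forall, not_le] at hnf
    obtain ⟨k, hk, hneg⟩ := hnf
    obtain ⟨m, hm⟩ := exists_nat_one_div_lt (neg_pos.2 hneg)
    exact Set.mem_iUnion.2 ⟨m, Set.mem_biUnion hk (by
      simp only [Set.mem_ofPred_eq]; linarith)⟩
  have hmono : Monotone U := by
    intro a b hab
    refine Set.biUnion_mono subset_rfl fun k _ δ hδ => ?_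
    have := Nat.one_div_le_one_div (α := ℝ) hab
    simp only [Set.mem_ofPred_eq] at hδ ⊢
    linarith
  obtain ⟨m, hm⟩ := hS.elim_directed_cover U hU hcover hmono.directed_le
  refine ⟨1 / ((m : ℝ) + 1), by positivity, fun δ hδ0 hδ => ?_⟩
  have hpos : 0 < ‖δ‖ := norm_pos_iff.2 hδ
  have hmem : ‖δ‖⁻¹ • δ ∈ S := by
    refine ⟨?_, by simp [hδ0]⟩
    simp [norm_smul, hpos.ne']
  obtain ⟨k, hk, hlt⟩ := Set.mem_iUnion₂.1 (hm hmem)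
  refine ⟨k, hk, ?_⟩
  simp only [Set.mem_ofPred_eq, Pi.smul_apply, ← smul_sub, inner_smul_right] at hlt
  rw [inv_mul_lt_iff₀ hpos] at hlt
  linarith

/-- A packing in which every displacement fixing the disk `i₀` brings some pair of touching
disks together at a definite rate is collectively jammed. -/
lemma collectivelyJammed_of_inner_le {Λ : Set Pt} {ι : Type} [Fintype ι] {p : ι → Pt}
    {r : ι → ℝ} (i₀ : ι) {c : ℝ} (hc : 0 < c)
    (h : ∀ δ : ι → Pt, δ i₀ = 0 → δ ≠ 0 →
      ∃ k : ι × ι × Pt, IsContact Λ p r k ∧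
        ⟪p k.1 - p k.2.1 + k.2.2, δ k.1 - δ k.2.1⟫ ≤ -(c * ‖δ‖)) :
    CollectivelyJammed Λ p r := by
  intro x hx hx0 hpack
  let δ : ℝ → ι → Pt := fun t i => (x t i - p i) - (x t i₀ - p i₀)
  have hδc : ContinuousOn (fun t => ‖δ t‖) (Set.Icc 0 1) := by
    refine ContinuousOn.norm (continuousOn_pi.2 fun i => ?_)
    exact ((hx i).sub continuousOn_const).sub ((hx i₀).sub continuousOn_const)
  have hgap : ∀ t ∈ Set.Icc (0 : ℝ) 1, δ t ≠ 0 → c / 2 ≤ ‖δ t‖ := by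
    intro t ht hne
    have hpos : 0 < ‖δ t‖ := norm_pos_iff.2 hne
    obtain ⟨⟨i, j, l⟩, ⟨hl, h0, hcon⟩, hin⟩ := h (δ t) (by simp [δ]) hne
    dsimp only at hl h0 hcon hin
    have h1 := (hpack t ht).2 i j l hl h0
    have e : x t i - x t j + l = (p i - p j + l) + (δ t i - δ t j) := by
      simp only [δ]; abel
    rw [e, ← hcon] at h1
    have h2 := norm_add_sq_real (p i - p j + l) (δ t i - δ t j)
    have h3 := pow_le_pow_left₀ (norm_nonneg _) h1 2
    have h4 : ‖δ t i - δ t j‖ ≤ 2 * ‖δ t‖ := by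
      linarith [norm_sub_le (δ t i) (δ t j), norm_le_pi_norm (δ t) i, norm_le_pi_norm (δ t) j]
    have h5 := pow_le_pow_left₀ (norm_nonneg _) h4 2
    have h6 : c / 2 * ‖δ t‖ ≤ ‖δ t‖ * ‖δ t‖ := by nlinarith
    exact le_of_mul_le_mul_right h6 hpos
  have hzero : ∀ t ∈ Set.Icc (0 : ℝ) 1, δ t = 0 := by
    intro t ht
    by_contra hne
    have hle := hgap t ht hne
    have hsub : Set.Icc 0 t ⊆ Set.Icc (0 : ℝ) 1 := Set.Icc_subset_Icc_right ht.2
    obtain ⟨u, hu, huc⟩ := intermediate_value_Icc ht.1 (hδc.mono hsub)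
      (show c / 4 ∈ Set.Icc ‖δ 0‖ ‖δ t‖ by
        have : δ 0 = 0 := by ext1 i; simp [δ, hx0]
        rw [this, norm_zero]
        constructor <;> linarith)
    dsimp only at huc
    have hu0 : δ u ≠ 0 := by
      intro h0
      rw [h0, norm_zero] at huc
      linarith
    linarith [hgap u (hsub hu) hu0]
  intro t ht i j
  have hi : ∀ i, x t i - p i = x t i₀ - p i₀ := fun i => sub_eq_zero.1 (congrFun (hzero t ht) i)
  rw [hi i, hi j]

/-- Centers of nearby configurations are close. -/
lemma norm_sub_le_pdist {ι : Type} [Fintype ι] (p q : ι → Pt) (i : ι) :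
    ‖p i - q i‖ ≤ pdist p q := by
  refine Real.le_sqrt_of_sq_le ?_
  exact Finset.single_le_sum (f := fun i => ‖p i - q i‖ ^ 2) (fun _ _ => sq_nonneg _)
    (Finset.mem_univ i)

/-- **Proposition 5.5.**  Let `(p, r)` be a collectively jammed packing of `n` disks
in the flat torus `ℝ²/Λ`, `Λ` spanned by the linearly independent vectors `v₁, v₂`.
Then there is an `ε > 0` such that every packing `(q, s)` within `ε` of `(p, r)` having
the same contact graph (the same set of contact triples) is also collectively jammed. -/
theorem nearby_same_graph_collectively_jammed
    (v₁ v₂ : Pt) (hli : LinearIndependent ℝ ![v₁, v₂])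
    (n : ℕ) (p : Fin n → Pt) (r : Fin n → ℝ)
    (hpack : IsPacking (lat v₁ v₂) p r)
    (hjam : CollectivelyJammed (lat v₁ v₂) p r) :
    ∃ ε > 0, ∀ (q : Fin n → Pt) (s : Fin n → ℝ),
      IsPacking (lat v₁ v₂) q s → pdist q p < ε → rdist s r < ε →
      (∀ c : Fin n × Fin n × Pt,
        IsContact (lat v₁ v₂) p r c ↔ IsContact (lat v₁ v₂) q s c) →
      CollectivelyJammed (lat v₁ v₂) q s := by
  rcases isEmpty_or_nonempty (Fin n) with hn | ⟨⟨i₀⟩⟩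
  · exact ⟨1, one_pos, fun q s _ _ _ _ x _ _ _ t _ i => isEmptyElim i⟩
  obtain ⟨c, hc, hrig⟩ := (hjam.infinitesimallyRigid hli hpack).exists_inner_le i₀
  refine ⟨c / 8, by positivity, fun q s _ hqp _ hgraph => ?_⟩
  refine collectivelyJammed_of_inner_le i₀ (half_pos hc) fun δ hδ0 hδ => ?_
  obtain ⟨⟨i, j, l⟩, hk, hin⟩ := hrig δ hδ0 hδ
  refine ⟨(i, j, l), (hgraph _).1 hk, ?_⟩
  dsimp only at hin ⊢
  have e : q i - q j + l = (p i - p j + l) + ((q i - p i) - (q j - p j)) := by abel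
  have h1 : ‖(q i - p i) - (q j - p j)‖ ≤ c / 4 := by
    linarith [norm_sub_le (q i - p i) (q j - p j), norm_sub_le_pdist q p i,
      norm_sub_le_pdist q p j]
  have h2 : ‖δ i - δ j‖ ≤ 2 * ‖δ‖ := by
    linarith [norm_sub_le (δ i) (δ j), norm_le_pi_norm δ i, norm_le_pi_norm δ j]
  have h3 : ⟪(q i - p i) - (q j - p j), δ i - δ j⟫ ≤ c / 4 * (2 * ‖δ‖) :=
    (real_inner_le_norm _ _).trans (mul_le_mul h1 h2 (norm_nonneg _) (by positivity))
  rw [e, inner_add_left]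
  linarith

end IsostaticPaper
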